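/- arXiv:1612.07720 — 5 statements merged into one kernel-verified Lean document; each statement's English description precedes it below -/
import Mathlib

section
/- Let L ≥ 0 and let n : ℝ³ → ℝ³ be Lipschitz with constant L. Let i₀, i₁, i₂ ∈ ℝ³ and v₀, v₁, v₂ ∈ ℝ³ satisfy ‖v_k‖ ≤ 1 and ⟨v_k, n(i_k)⟩ = 0 for k = 0, 1, 2. Then for all λ₀, λ₁, λ₂ ≥ 0 with λ₀ + λ₁ + λ₂ = 1, setting x := λ₀ i₀ + λ₁ i₁ + λ₂ i₂, one has |⟨λ₀ v₀ + λ₁ v₁ + λ₂ v₂, n(x)⟩| ≤ L · max_{k=0,1,2} ‖x − i_k‖. -/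
open scoped RealInnerProductSpace

/-- A vector of norm at most one that is orthogonal to `b` has inner product with `a`
at most `‖a - b‖` in absolute value. -/
theorem abs_inner_le_norm_sub_of_inner_eq_zero {E : Type*} [NormedAddCommGroup E]
    [InnerProductSpace ℝ E] {v a b : E} (hv : ‖v‖ ≤ 1) (hb : ⟪v, b⟫ = 0) :
    |⟪v, a⟫| ≤ ‖a - b‖ := by
  calc |⟪v, a⟫| = |⟪v, a - b⟫| := by rw [inner_sub_right, hb, sub_zero]
    _ ≤ ‖v‖ * ‖a - b‖ := abs_real_inner_le_norm v (a - b)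
    _ ≤ ‖a - b‖ := mul_le_of_le_one_left (norm_nonneg _) hv

/-- If `n` is `L`-Lipschitz, the discrete vectors `v_k` have norm at most one and are
orthogonal to `n` at the vertices `i_k`, then the affine interpolant at a barycentric
point `x` is almost orthogonal to `n x`. -/
theorem interpolant_almost_tangent (L : ℝ) (hL : 0 ≤ L)
    (n : EuclideanSpace ℝ (Fin 3) → EuclideanSpace ℝ (Fin 3))
    (hn : ∀ x y, ‖n x - n y‖ ≤ L * ‖x - y‖)
    (i₀ i₁ i₂ v₀ v₁ v₂ : EuclideanSpace ℝ (Fin 3))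
    (hv₀ : ‖v₀‖ ≤ 1) (hv₁ : ‖v₁‖ ≤ 1) (hv₂ : ‖v₂‖ ≤ 1)
    (ho₀ : ⟪v₀, n i₀⟫ = 0) (ho₁ : ⟪v₁, n i₁⟫ = 0) (ho₂ : ⟪v₂, n i₂⟫ = 0)
    (l₀ l₁ l₂ : ℝ) (h₀ : 0 ≤ l₀) (h₁ : 0 ≤ l₁) (h₂ : 0 ≤ l₂)
    (hsum : l₀ + l₁ + l₂ = 1) :
    |⟪l₀ • v₀ + l₁ • v₁ + l₂ • v₂, n (l₀ • i₀ + l₁ • i₁ + l₂ • i₂)⟫| ≤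
      L * max (max ‖(l₀ • i₀ + l₁ • i₁ + l₂ • i₂) - i₀‖
                   ‖(l₀ • i₀ + l₁ • i₁ + l₂ • i₂) - i₁‖)
              ‖(l₀ • i₀ + l₁ • i₁ + l₂ • i₂) - i₂‖ := by
  set x := l₀ • i₀ + l₁ • i₁ + l₂ • i₂
  set M := max (max ‖x - i₀‖ ‖x - i₁‖) ‖x - i₂‖
  have bound {v i : EuclideanSpace ℝ (Fin 3)} (hv : ‖v‖ ≤ 1) (ho : ⟪v, n i⟫ = 0)
      (hM : ‖x - i‖ ≤ M) : |⟪v, n x⟫| ≤ L * M :=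
    (abs_inner_le_norm_sub_of_inner_eq_zero hv ho).trans
      ((hn x i).trans (mul_le_mul_of_nonneg_left hM hL))
  have b₀ := bound hv₀ ho₀ ((le_max_left _ _).trans (le_max_left _ _))
  have b₁ := bound hv₁ ho₁ ((le_max_right _ _).trans (le_max_left _ _))
  have b₂ := bound hv₂ ho₂ (le_max_right _ _)
  simp only [inner_add_left, real_inner_smul_left]
  calc |l₀ * ⟪v₀, n x⟫ + l₁ * ⟪v₁, n x⟫ + l₂ * ⟪v₂, n x⟫|
      ≤ |l₀ * ⟪v₀, n x⟫| + |l₁ * ⟪v₁, n x⟫| + |l₂ * ⟪v₂, n x⟫| := abs_add_three _ _ _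
    _ = l₀ * |⟪v₀, n x⟫| + l₁ * |⟪v₁, n x⟫| + l₂ * |⟪v₂, n x⟫| := by
      rw [abs_mul, abs_mul, abs_mul, abs_of_nonneg h₀, abs_of_nonneg h₁, abs_of_nonneg h₂]
    _ ≤ l₀ * (L * M) + l₁ * (L * M) + l₂ * (L * M) := by gcongr
    _ = L * M := by rw [← add_mul, ← add_mul, hsum, one_mul]
end

section
/- Let v : ℝⁿ → ℝᵐ be an affine map and let i₀, i₁, i₂ ∈ ℝⁿ be such that ‖v(i₀)‖ = ‖v(i₁)‖ = ‖v(i₂)‖ = 1. Then for every x in the convex hull of {i₀, i₁, i₂}, one has (1 − ‖v(x)‖²)² ≤ 8 (‖v(i₁) − v(i₀)‖² + ‖v(i₂) − v(i₀)‖²). -/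
/-- The Ginzburg-Landau defect of a point of the unit ball is controlled by its distance to any
unit vector. -/
lemma one_sub_norm_sq_sq_le {E : Type*} [SeminormedAddCommGroup E] {y p : E}
    (hy : ‖y‖ ≤ 1) (hp : ‖p‖ = 1) : (1 - ‖y‖ ^ 2) ^ 2 ≤ 4 * ‖y - p‖ ^ 2 := by
  have hdist : 1 - ‖y‖ ≤ ‖y - p‖ := by
    simpa [hp, norm_sub_rev] using norm_sub_norm_le p y
  have hsq : (1 - ‖y‖) ^ 2 ≤ ‖y - p‖ ^ 2 := by gcongr
  have hsum : (1 + ‖y‖) ^ 2 ≤ 4 := by nlinarith [norm_nonneg y]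
  calc (1 - ‖y‖ ^ 2) ^ 2 = (1 + ‖y‖) ^ 2 * (1 - ‖y‖) ^ 2 := by ring
    _ ≤ 4 * ‖y - p‖ ^ 2 := by gcongr

/-- An affine map sends the convex hull of a set into every closed ball containing the image of
the set. -/
lemma AffineMap.mem_closedBall_of_mem_convexHull {E F : Type*} [AddCommGroup E] [Module ℝ E]
    [SeminormedAddCommGroup F] [NormedSpace ℝ F] (f : E →ᵃ[ℝ] F) {s : Set E} {c : F} {r : ℝ}
    (hs : ∀ y ∈ s, f y ∈ Metric.closedBall c r) {x : E} (hx : x ∈ convexHull ℝ s) :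
    f x ∈ Metric.closedBall c r :=
  convexHull_min hs ((convex_closedBall c r).affine_preimage f) hx

/-- Discrete Ginzburg-Landau pointwise bound: if an affine map has unit norm at the
three vertices of a triangle, then at every point of the triangle the quantity
`(1 - ‖v x‖²)²` is controlled by the squared differences of the vertex values. -/
theorem affine_interpolant_GL_pointwise (n m : ℕ)
    (v : EuclideanSpace ℝ (Fin n) →ᵃ[ℝ] EuclideanSpace ℝ (Fin m))
    (i₀ i₁ i₂ : EuclideanSpace ℝ (Fin n))
    (h₀ : ‖v i₀‖ = 1) (h₁ : ‖v i₁‖ = 1) (h₂ : ‖v i₂‖ = 1)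
    (x : EuclideanSpace ℝ (Fin n)) (hx : x ∈ convexHull ℝ {i₀, i₁, i₂}) :
    (1 - ‖v x‖ ^ 2) ^ 2 ≤ 8 * (‖v i₁ - v i₀‖ ^ 2 + ‖v i₂ - v i₀‖ ^ 2) := by
  have hball : ‖v x‖ ≤ 1 := by
    rw [← mem_closedBall_zero_iff]
    refine v.mem_closedBall_of_mem_convexHull ?_ hx
    rintro y (rfl | rfl | rfl) <;> simp [*]
  have hdist : ‖v x - v i₀‖ ≤ √(‖v i₁ - v i₀‖ ^ 2 + ‖v i₂ - v i₀‖ ^ 2) := by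
    rw [← mem_closedBall_iff_norm]
    refine v.mem_closedBall_of_mem_convexHull ?_ hx
    rintro y (rfl | rfl | rfl) <;> rw [mem_closedBall_iff_norm] <;> apply Real.le_sqrt_of_sq_le
    · rw [sub_self, norm_zero, zero_pow two_ne_zero]; positivity
    · linarith [sq_nonneg ‖v i₂ - v i₀‖]
    · linarith [sq_nonneg ‖v i₁ - v i₀‖]
  have hsq := (Real.le_sqrt (norm_nonneg _) (by positivity)).1 hdist
  linarith [one_sub_norm_sq_sq_le hball h₀, sq_nonneg ‖v i₁ - v i₀‖, sq_nonneg ‖v i₂ - v i₀‖]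
end

section
/- For every Λ ≥ 1 there exists a constant C > 0, depending only on Λ, with the following property. Let T_ref ⊂ ℝ² be the convex hull of (0,0), (1,0), (0,1); let φ : ℝ² → ℝ² be a bijective affine map with Lipschitz constant Lip(φ) ≤ Λ and Lip(φ⁻¹) ≤ Λ, and set T := φ(T_ref). If ψ : ℝ² → ℝ² is an affine map and d ≥ 0 is such that ‖ψ(x) − x‖ ≤ d for all x ∈ T, then the linear part L of ψ satisfies ‖L − Id‖ ≤ C d, where ‖·‖ is the operator norm; in particular ψ is Lipschitz with constant at most 1 + C d. -/
/-- The reference triangle in `ℝ²`: the convex hull of `(0,0)`, `(1,0)` and `(0,1)`. -/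
noncomputable def refTriangle : Set (EuclideanSpace ℝ (Fin 2)) :=
  convexHull ℝ {0, (WithLp.equiv 2 (Fin 2 → ℝ)).symm ![1, 0],
    (WithLp.equiv 2 (Fin 2 → ℝ)).symm ![0, 1]}

/-- Two points displaced by at most `d` under an affine map `ψ` differ by a vector displaced by at
most `2 * d` under the linear part of `ψ`. -/
theorem AffineMap.norm_linear_vsub_sub_le {E : Type*} [NormedAddCommGroup E] [NormedSpace ℝ E]
    (ψ : E →ᵃ[ℝ] E) {d : ℝ} {p q : E} (hp : ‖ψ p - p‖ ≤ d) (hq : ‖ψ q - q‖ ≤ d) :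
    ‖ψ.linear (p - q) - (p - q)‖ ≤ 2 * d := by
  have h : ψ.linear (p - q) = ψ p - ψ q := ψ.linearMap_vsub p q
  rw [h, sub_sub_sub_comm]
  linarith [norm_sub_le (ψ p - p) (ψ q - q)]

/-- On a quasi-uniform triangle of size 1, an affine map moving every point by at most `d`
has linear part `Cd`-close to the identity, hence is `(1 + Cd)`-Lipschitz. -/
theorem affine_close_to_id_on_triangle (Λ : ℝ) (hΛ : 1 ≤ Λ) :
    ∃ C > (0 : ℝ), ∀ φ ψ : EuclideanSpace ℝ (Fin 2) →ᵃ[ℝ] EuclideanSpace ℝ (Fin 2),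
      Function.Bijective φ →
      (∀ x y, ‖φ x - φ y‖ ≤ Λ * ‖x - y‖) →
      (∀ x y, ‖x - y‖ ≤ Λ * ‖φ x - φ y‖) →
      ∀ d : ℝ, 0 ≤ d →
      (∀ x ∈ φ '' refTriangle, ‖ψ x - x‖ ≤ d) →
      ‖LinearMap.toContinuousLinearMap ψ.linear
          - ContinuousLinearMap.id ℝ (EuclideanSpace ℝ (Fin 2))‖ ≤ C * d ∧
      ∀ x y, ‖ψ x - ψ y‖ ≤ (1 + C * d) * ‖x - y‖ := by
  refine ⟨4 * Λ, by linarith, fun φ ψ hφ _ hφ' d hd hψ ↦ ?_⟩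
  set A := LinearMap.toContinuousLinearMap ψ.linear
    - ContinuousLinearMap.id ℝ (EuclideanSpace ℝ (Fin 2)) with hA
  have hsub (x y : EuclideanSpace ℝ (Fin 2)) : φ.linear (x - y) = φ x - φ y :=
    φ.linearMap_vsub x y
  have hvert : ∀ e ∈ refTriangle, ‖A (φ.linear e)‖ ≤ 2 * d := by
    intro e he
    have h0 : (0 : EuclideanSpace ℝ (Fin 2)) ∈ refTriangle :=
      subset_convexHull ℝ _ (by simp)
    have h := ψ.norm_linear_vsub_sub_le (hψ _ ⟨e, he, rfl⟩) (hψ _ ⟨0, h0, rfl⟩)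
    rw [← hsub, sub_zero] at h
    simpa [hA] using h
  have h₁ := hvert !₂[1, 0] (subset_convexHull ℝ _ (by simp))
  have h₂ := hvert !₂[0, 1] (subset_convexHull ℝ _ (by simp))
  have hnorm : ‖A‖ ≤ 4 * Λ * d := by
    refine A.opNorm_le_bound (by positivity) fun v ↦ ?_
    obtain ⟨u, rfl⟩ := φ.linear_surjective_iff.mpr hφ.surjective v
    have hu : ‖u‖ ≤ Λ * ‖φ.linear u‖ := by
      have h := hφ' u 0
      rwa [← hsub, sub_zero] at h
    have hdecomp : u = u 0 • !₂[(1 : ℝ), 0] + u 1 • !₂[(0 : ℝ), 1] := by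
      ext i
      fin_cases i <;> simp
    have hu₀ : ‖u 0‖ ≤ ‖u‖ := PiLp.norm_apply_le u 0
    have hu₁ : ‖u 1‖ ≤ ‖u‖ := PiLp.norm_apply_le u 1
    calc ‖A (φ.linear u)‖
        = ‖u 0 • A (φ.linear !₂[1, 0]) + u 1 • A (φ.linear !₂[0, 1])‖ := by
          conv_lhs => rw [hdecomp]
          simp only [map_add, map_smul]
      _ ≤ ‖u 0‖ * ‖A (φ.linear !₂[1, 0])‖ + ‖u 1‖ * ‖A (φ.linear !₂[0, 1])‖ := by
          simpa only [norm_smul] using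
            norm_add_le (u 0 • A (φ.linear !₂[1, 0])) (u 1 • A (φ.linear !₂[0, 1]))
      _ ≤ ‖u‖ * (2 * d) + ‖u‖ * (2 * d) := by gcongr
      _ = 4 * d * ‖u‖ := by ring
      _ ≤ 4 * d * (Λ * ‖φ.linear u‖) := by gcongr
      _ = 4 * Λ * d * ‖φ.linear u‖ := by ring
  refine ⟨hnorm, fun x y ↦ ?_⟩
  have hxy : ψ x - ψ y = (x - y) + A (x - y) := by
    have h : ψ.linear (x - y) = ψ x - ψ y := ψ.linearMap_vsub x y
    rw [← h]
    simp [hA]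
  calc ‖ψ x - ψ y‖ ≤ ‖x - y‖ + ‖A (x - y)‖ := hxy ▸ norm_add_le _ _
    _ ≤ ‖x - y‖ + 4 * Λ * d * ‖x - y‖ := by gcongr; exact A.le_of_opNorm_le hnorm _
    _ = (1 + 4 * Λ * d) * ‖x - y‖ := by ring
end

section
/- Let u, w : ℝ² → ℝ² be continuously differentiable maps with compact support, and let φ : ℝ² → ℝ be continuously differentiable with bounded derivative. Then |∫_{ℝ²} φ(x) (det Du(x) − det Dw(x)) dx| ≤ (sup_{x ∈ ℝ²} ‖Dφ(x)‖) · ‖u − w‖_{L²(ℝ²)} · (‖Du‖_{L²(ℝ²)} + ‖Dw‖_{L²(ℝ²)}). -/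
open MeasureTheory

section IntegrationByParts

open Filter Topology

variable {E : Type*} [NormedAddCommGroup E] [NormedSpace ℝ E]
  [MeasurableSpace E] [BorelSpace E] {μ : Measure E} [μ.IsAddHaarMeasure]

/-- Discrete integration by parts: difference quotients are skew-adjoint up to reflection. -/
lemma integral_differenceQuotient_mul {F b : E → ℝ} (hF : Continuous F) (hb : Continuous b)
    (hF_supp : HasCompactSupport F) (t : ℝ) (v : E) :
    ∫ x, (t⁻¹ • (F (x + t • v) - F x)) * b x ∂μ =
      ∫ x, (t⁻¹ • (b (x + t • (-v)) - b x)) * F x ∂μ := by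
  have shift : ∫ x, F (x + t • v) * b x ∂μ = ∫ x, b (x + t • (-v)) * F x ∂μ := by
    rw [← integral_add_right_eq_self _ (t • (-v))]
    simp [mul_comm]
  have hFt : HasCompactSupport fun x ↦ F (x + t • v) :=
    hF_supp.comp_homeomorph (Homeomorph.addRight (t • v))
  have h1 : Integrable (fun x ↦ F (x + t • v) * b x) μ :=
    Continuous.integrable_of_hasCompactSupport (by fun_prop) hFt.mul_right
  have h2 : Integrable (fun x ↦ F x * b x) μ :=
    Continuous.integrable_of_hasCompactSupport (by fun_prop) hF_supp.mul_right
  have h3 : Integrable (fun x ↦ b (x + t • (-v)) * F x) μ :=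
    Continuous.integrable_of_hasCompactSupport (by fun_prop) hF_supp.mul_left
  have h4 : Integrable (fun x ↦ b x * F x) μ :=
    Continuous.integrable_of_hasCompactSupport (by fun_prop) hF_supp.mul_left
  simp only [smul_eq_mul, mul_assoc, integral_const_mul]
  simp_rw [sub_mul]
  rw [integral_sub h1 h2, integral_sub h3 h4, shift]
  simp [mul_comm]

variable [FiniteDimensional ℝ E]

/-- For `C¹` functions with compact support, directional derivatives may be exchanged in the
`L²` pairing. -/
lemma integral_fderiv_mul_fderiv_comm {f b : E → ℝ} (hf : ContDiff ℝ 1 f) (hb : ContDiff ℝ 1 b)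
    (hf_supp : HasCompactSupport f) (hb_supp : HasCompactSupport b) (v w : E) :
    ∫ x, fderiv ℝ f x v * fderiv ℝ b x w ∂μ = ∫ x, fderiv ℝ f x w * fderiv ℝ b x v ∂μ := by
  have hfd : Differentiable ℝ f := hf.differentiable one_ne_zero
  have hbd : Differentiable ℝ b := hb.differentiable one_ne_zero
  have hf' : Continuous (fderiv ℝ f) := hf.continuous_fderiv one_ne_zero
  have hb' : Continuous (fderiv ℝ b) := hb.continuous_fderiv one_ne_zero
  have hfw_supp : HasCompactSupport fun x ↦ fderiv ℝ f x w := hf_supp.fderiv_apply ℝ w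
  have hbw_supp : HasCompactSupport fun x ↦ fderiv ℝ b x w := hb_supp.fderiv_apply ℝ w
  obtain ⟨C, hC⟩ := hf.lipschitzWith_of_hasCompactSupport hf_supp one_ne_zero
  obtain ⟨D, hD⟩ := hb.lipschitzWith_of_hasCompactSupport hb_supp one_ne_zero
  have lim₁ := LipschitzWith.integral_inv_smul_sub_mul_tendsto_integral_lineDeriv_mul (μ := μ) hC
    (Continuous.integrable_of_hasCompactSupport (by fun_prop) hbw_supp) v
  have lim₂ := (LipschitzWith.integral_inv_smul_sub_mul_tendsto_integral_lineDeriv_mul (μ := μ) hD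
    (Continuous.integrable_of_hasCompactSupport (by fun_prop) hfw_supp) (-v)).neg
  have key (t : ℝ) : ∫ x, (t⁻¹ • (f (x + t • v) - f x)) * fderiv ℝ b x w ∂μ =
      -∫ x, (t⁻¹ • (b (x + t • (-v)) - b x)) * fderiv ℝ f x w ∂μ := by
    have hq (x : E) : HasFDerivAt (fun x ↦ t⁻¹ • (f (x + t • v) - f x))
        (t⁻¹ • (fderiv ℝ f (x + t • v) - fderiv ℝ f x)) x := by
      have h := (hfd (x + t • v)).hasFDerivAt.comp x ((hasFDerivAt_id x).add_const (t • v))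
      exact (h.sub (hfd x).hasFDerivAt).const_smul t⁻¹
    have hfc : Continuous f := hf.continuous
    have hbc : Continuous b := hb.continuous
    rw [← integral_differenceQuotient_mul (by fun_prop) hb.continuous hfw_supp]
    have ibp := integral_mul_fderiv_eq_neg_fderiv_mul_of_integrable (μ := μ)
      (f := fun x ↦ t⁻¹ • (f (x + t • v) - f x)) (g := b) (v := w) ?_ ?_ ?_
      (fun x _ ↦ (hq x).differentiableAt) (fun x _ ↦ hbd x)
    · simp only [(hq _).fderiv] at ibp
      simpa using ibp
    · simp only [(hq _).fderiv]
      exact Continuous.integrable_of_hasCompactSupport (by fun_prop) hb_supp.mul_left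
    · exact Continuous.integrable_of_hasCompactSupport (by fun_prop) hbw_supp.mul_left
    · exact Continuous.integrable_of_hasCompactSupport (by fun_prop) hb_supp.mul_left
  simp only [key] at lim₁
  have h := tendsto_nhds_unique lim₁ lim₂
  simp only [(hfd _).lineDeriv_eq_fderiv, (hbd _).lineDeriv_eq_fderiv] at h
  rw [h, ← integral_neg]
  congr 1 with x
  simp [mul_comm]

/-- Integration by parts for the Jacobian `da ∧ db`, with `C¹` data only. -/
lemma integral_mul_jacobian_eq_neg {φ a b : E → ℝ} (hφ : ContDiff ℝ 1 φ) (ha : ContDiff ℝ 1 a)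
    (hb : ContDiff ℝ 1 b) (ha_supp : HasCompactSupport a) (hb_supp : HasCompactSupport b)
    (v w : E) :
    ∫ x, φ x * (fderiv ℝ a x v * fderiv ℝ b x w - fderiv ℝ a x w * fderiv ℝ b x v) ∂μ =
      -∫ x, a x * (fderiv ℝ φ x v * fderiv ℝ b x w - fderiv ℝ φ x w * fderiv ℝ b x v) ∂μ := by
  have hφc := hφ.continuous
  have hac := ha.continuous
  have hφ' : Continuous (fderiv ℝ φ) := hφ.continuous_fderiv one_ne_zero
  have ha' : Continuous (fderiv ℝ a) := ha.continuous_fderiv one_ne_zero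
  have hb' : Continuous (fderiv ℝ b) := hb.continuous_fderiv one_ne_zero
  have hfd (x : E) : fderiv ℝ (fun x ↦ φ x * a x) x = φ x • fderiv ℝ a x + a x • fderiv ℝ φ x :=
    fderiv_fun_mul (hφ.differentiable one_ne_zero x) (ha.differentiable one_ne_zero x)
  have hcomm := integral_fderiv_mul_fderiv_comm (μ := μ) (hφ.mul ha) hb ha_supp.mul_left hb_supp v w
  simp only [hfd] at hcomm
  have hsupp (u : E) : HasCompactSupport fun x ↦ fderiv ℝ b x u := hb_supp.fderiv_apply ℝ u
  have hint (u u' : E) : Integrable (fun x ↦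
      (φ x • fderiv ℝ a x + a x • fderiv ℝ φ x) u * fderiv ℝ b x u') μ :=
    Continuous.integrable_of_hasCompactSupport (by fun_prop) (hsupp u').mul_left
  rw [← sub_eq_zero, ← integral_sub (hint v w) (hint w v)] at hcomm
  rw [← sub_eq_zero, sub_neg_eq_add, ← integral_add, ← hcomm]
  · congr 1 with x
    simp
    ring
  · refine Continuous.integrable_of_hasCompactSupport (by fun_prop) (HasCompactSupport.mul_left ?_)
    exact (hsupp w).mul_left.sub (hsupp v).mul_left
  · exact Continuous.integrable_of_hasCompactSupport (by fun_prop) ha_supp.mul_right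

end IntegrationByParts

/-- The Cauchy–Schwarz inequality for integrals of nonnegative square-integrable functions. -/
lemma integral_mul_le_sqrt_mul_sqrt {α : Type*} [MeasurableSpace α] {μ : Measure α} {f g : α → ℝ}
    (hf : MemLp f 2 μ) (hg : MemLp g 2 μ) (hf₀ : 0 ≤ f) (hg₀ : 0 ≤ g) :
    ∫ x, f x * g x ∂μ ≤ Real.sqrt (∫ x, f x ^ 2 ∂μ) * Real.sqrt (∫ x, g x ^ 2 ∂μ) := by
  have h := integral_mul_le_Lp_mul_Lq_of_nonneg (μ := μ) Real.HolderConjugate.two_two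
    (.of_forall hf₀) (.of_forall hg₀) (by simpa using hf) (by simpa using hg)
  simpa [Real.sqrt_eq_rpow] using h

section Plane

local notation "ℝ²" => EuclideanSpace ℝ (Fin 2)
local notation "e₀" => EuclideanSpace.single (0 : Fin 2) (1 : ℝ)
local notation "e₁" => EuclideanSpace.single (1 : Fin 2) (1 : ℝ)

lemma det_euclideanPlane (A : ℝ² →L[ℝ] ℝ²) :
    A.toLinearMap.det = A e₀ 0 * A e₁ 1 - A e₁ 0 * A e₀ 1 := by
  rw [← LinearMap.det_toMatrix (EuclideanSpace.basisFun (Fin 2) ℝ).toBasis, Matrix.det_fin_two]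
  simp [LinearMap.toMatrix_apply]

/-- The contraction of a vector and a covector with the cofactor form of `B` is bounded by the
product of the norms. -/
lemma abs_cofactor_pairing_le (p : ℝ² →L[ℝ] ℝ) (B : ℝ² →L[ℝ] ℝ²) (v : ℝ²) :
    |v 0 * (p e₀ * B e₁ 1 - p e₁ * B e₀ 1) - v 1 * (p e₀ * B e₁ 0 - p e₁ * B e₀ 0)| ≤
      ‖p‖ * (‖v‖ * ‖B‖) := by
  set z : ℝ² := p e₀ • e₁ - p e₁ • e₀ with hz
  set z' : ℝ² := p e₀ • e₀ + p e₁ • e₁ with hz'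
  set Jv : ℝ² := v 0 • e₁ - v 1 • e₀ with hJv
  have hzsq : ‖z‖ ^ 2 = p e₀ ^ 2 + p e₁ ^ 2 := by
    simp [hz, EuclideanSpace.norm_sq_eq, Fin.sum_univ_two]; ring
  have hzz' : ‖z'‖ = ‖z‖ := by
    rw [← sq_eq_sq₀ (norm_nonneg _) (norm_nonneg _), hzsq]
    simp [hz', EuclideanSpace.norm_sq_eq, Fin.sum_univ_two]
  have hJ : ‖Jv‖ = ‖v‖ := by
    rw [← sq_eq_sq₀ (norm_nonneg _) (norm_nonneg _)]
    simp [hJv, EuclideanSpace.norm_sq_eq, Fin.sum_univ_two]; ring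
  have hzp : ‖z‖ ≤ ‖p‖ := by
    have h : ‖z‖ ^ 2 ≤ ‖p‖ * ‖z‖ := by
      calc ‖z‖ ^ 2 = p z' := by rw [hzsq, hz']; simp; ring
        _ ≤ ‖p z'‖ := le_abs_self _
        _ ≤ ‖p‖ * ‖z‖ := hzz' ▸ p.le_opNorm z'
    by_contra! hlt
    nlinarith [norm_nonneg p]
  have hinner : v 0 * (p e₀ * B e₁ 1 - p e₁ * B e₀ 1) - v 1 * (p e₀ * B e₁ 0 - p e₁ * B e₀ 0) =
      inner ℝ (B z) Jv := by
    simp [hz, hJv, PiLp.inner_apply, Fin.sum_univ_two]; ring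
  calc _ = |inner ℝ (B z) Jv| := by rw [hinner]
    _ ≤ ‖B z‖ * ‖Jv‖ := abs_real_inner_le_norm _ _
    _ ≤ (‖B‖ * ‖p‖) * ‖v‖ := by
      rw [hJ]
      gcongr
      exact (B.le_opNorm z).trans (by gcongr)
    _ = _ := by ring

lemma fderiv_euclidean_apply {f : ℝ² → ℝ²} {x : ℝ²} (hf : DifferentiableAt ℝ f x) (i : Fin 2)
    (v : ℝ²) : fderiv ℝ (fun y ↦ f y i) x v = fderiv ℝ f x v i := by
  have h := (EuclideanSpace.proj (𝕜 := ℝ) i : ℝ² →L[ℝ] ℝ).hasFDerivAt.comp x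
    hf.hasFDerivAt
  rw [show fderiv ℝ (fun y ↦ f y i) x = _ from h.fderiv]
  rfl

/-- Integration by parts for the difference of two Jacobian determinants. -/
lemma integral_mul_det_sub_det {u w : ℝ² → ℝ²} {φ : ℝ² → ℝ} (hu : ContDiff ℝ 1 u)
    (hw : ContDiff ℝ 1 w) (hu_supp : HasCompactSupport u) (hw_supp : HasCompactSupport w)
    (hφ : ContDiff ℝ 1 φ) :
    ∫ x, φ x * ((fderiv ℝ u x).toLinearMap.det - (fderiv ℝ w x).toLinearMap.det) =
      ∫ x, -(1 / 2) *
        ((u x - w x) 0 * (fderiv ℝ φ x e₀ * (fderiv ℝ u x + fderiv ℝ w x) e₁ 1 -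
          fderiv ℝ φ x e₁ * (fderiv ℝ u x + fderiv ℝ w x) e₀ 1) -
        (u x - w x) 1 * (fderiv ℝ φ x e₀ * (fderiv ℝ u x + fderiv ℝ w x) e₁ 0 -
          fderiv ℝ φ x e₁ * (fderiv ℝ u x + fderiv ℝ w x) e₀ 0)) := by
  have hud := hu.differentiable one_ne_zero
  have hwd := hw.differentiable one_ne_zero
  have hv : ContDiff ℝ 1 (u - w) := hu.sub hw
  have hs : ContDiff ℝ 1 (u + w) := hu.add hw
  have hv_supp : HasCompactSupport (u - w) := hu_supp.sub hw_supp
  have hs_supp : HasCompactSupport (u + w) := hu_supp.add hw_supp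
  have hvd := hv.differentiable one_ne_zero
  have hsd := hs.differentiable one_ne_zero
  have hvi (i : Fin 2) : ContDiff ℝ 1 fun x ↦ (u - w) x i := contDiff_euclidean.1 hv i
  have hsi (i : Fin 2) : ContDiff ℝ 1 fun x ↦ (u + w) x i := contDiff_euclidean.1 hs i
  have hvi_supp (i : Fin 2) : HasCompactSupport fun x ↦ (u - w) x i :=
    hv_supp.comp_left (g := fun y : ℝ² ↦ y i) rfl
  have hsi_supp (i : Fin 2) : HasCompactSupport fun x ↦ (u + w) x i :=
    hs_supp.comp_left (g := fun y : ℝ² ↦ y i) rfl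
  have hparts (i j : Fin 2) := integral_mul_jacobian_eq_neg (μ := volume) hφ (hvi i) (hsi j)
    (hvi_supp i) (hsi_supp j) e₀ e₁
  simp only [fderiv_euclidean_apply (hvd _), fderiv_euclidean_apply (hsd _)] at hparts
  have hφc := hφ.continuous
  have hφ' : Continuous (fderiv ℝ φ) := hφ.continuous_fderiv one_ne_zero
  have hv' : Continuous (fderiv ℝ (u - w)) := hv.continuous_fderiv one_ne_zero
  have hs' : Continuous (fderiv ℝ (u + w)) := hs.continuous_fderiv one_ne_zero
  have hvc (i : Fin 2) := (hvi i).continuous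
  have happ {f : ℝ² → ℝ²} (hf : Continuous (fderiv ℝ f)) (e : ℝ²) (i : Fin 2) :
      Continuous fun x ↦ fderiv ℝ f x e i := by fun_prop
  have hsupp (e : ℝ²) (i : Fin 2) : HasCompactSupport fun x ↦ fderiv ℝ (u + w) x e i :=
    (hs_supp.fderiv_apply ℝ e).comp_left (g := fun y : ℝ² ↦ y i) rfl
  have hint (i j : Fin 2) : Integrable fun x ↦ φ x * (fderiv ℝ (u - w) x e₀ i *
      fderiv ℝ (u + w) x e₁ j - fderiv ℝ (u - w) x e₁ i * fderiv ℝ (u + w) x e₀ j) :=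
    Continuous.integrable_of_hasCompactSupport
      (by have := happ hv'; have := happ hs'; fun_prop)
      (((hsupp e₁ j).mul_left.sub (hsupp e₀ j).mul_left).mul_left)
  have hint' (i j : Fin 2) : Integrable fun x ↦ (u - w) x i * (fderiv ℝ φ x e₀ *
      fderiv ℝ (u + w) x e₁ j - fderiv ℝ φ x e₁ * fderiv ℝ (u + w) x e₀ j) :=
    Continuous.integrable_of_hasCompactSupport
      (by have := happ hs'; have := hvc i; fun_prop) (hvi_supp i).mul_right
  have hfs (x : ℝ²) : fderiv ℝ (u + w) x = fderiv ℝ u x + fderiv ℝ w x :=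
    fderiv_add (hud x) (hwd x)
  have hfv (x : ℝ²) : fderiv ℝ (u - w) x = fderiv ℝ u x - fderiv ℝ w x :=
    fderiv_sub (hud x) (hwd x)
  have hleft := integral_sub (hint 0 1) (hint 1 0)
  have hright := integral_sub (hint' 0 1) (hint' 1 0)
  simp only [hfs, hfv] at hleft hright hparts
  simp only [← Pi.sub_apply u w]
  rw [integral_const_mul, hright]
  rw [hparts, hparts] at hleft
  have hdet : ∫ x, φ x * ((fderiv ℝ u x).toLinearMap.det - (fderiv ℝ w x).toLinearMap.det) =
      (1 / 2) * (∫ x, (φ x * ((fderiv ℝ u x - fderiv ℝ w x) e₀ 0 *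
          (fderiv ℝ u x + fderiv ℝ w x) e₁ 1 -
        (fderiv ℝ u x - fderiv ℝ w x) e₁ 0 * (fderiv ℝ u x + fderiv ℝ w x) e₀ 1) -
        φ x * ((fderiv ℝ u x - fderiv ℝ w x) e₀ 1 * (fderiv ℝ u x + fderiv ℝ w x) e₁ 0 -
        (fderiv ℝ u x - fderiv ℝ w x) e₁ 1 * (fderiv ℝ u x + fderiv ℝ w x) e₀ 0))) := by
    rw [← integral_const_mul]
    congr 1 with x
    rw [det_euclideanPlane, det_euclideanPlane]
    simp
    ring
  rw [hdet, hleft]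
  ring

end Plane

/-- Flat-norm continuity of the Jacobian determinant in the plane. -/
theorem jacobian_flat_continuity
    (u w : EuclideanSpace ℝ (Fin 2) → EuclideanSpace ℝ (Fin 2))
    (hu : ContDiff ℝ 1 u) (hw : ContDiff ℝ 1 w)
    (hu_supp : HasCompactSupport u) (hw_supp : HasCompactSupport w)
    (φ : EuclideanSpace ℝ (Fin 2) → ℝ) (hφ : ContDiff ℝ 1 φ)
    (hφ_bdd : ∃ K : ℝ, ∀ x, ‖fderiv ℝ φ x‖ ≤ K) :
    |∫ x, φ x * ((fderiv ℝ u x).toLinearMap.det - (fderiv ℝ w x).toLinearMap.det)| ≤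
      (⨆ x, ‖fderiv ℝ φ x‖) *
        Real.sqrt (∫ x, ‖u x - w x‖ ^ 2) *
        (Real.sqrt (∫ x, ‖fderiv ℝ u x‖ ^ 2) + Real.sqrt (∫ x, ‖fderiv ℝ w x‖ ^ 2)) := by
  set K := ⨆ x, ‖fderiv ℝ φ x‖
  have hK (x) : ‖fderiv ℝ φ x‖ ≤ K := by
    obtain ⟨C, hC⟩ := hφ_bdd
    exact le_ciSup (f := fun x ↦ ‖fderiv ℝ φ x‖) ⟨C, Set.forall_mem_range.2 hC⟩ x
  have hK₀ : 0 ≤ K := (norm_nonneg _).trans (hK 0)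
  have hv_supp : HasCompactSupport fun x ↦ ‖u x - w x‖ := (hu_supp.sub hw_supp).norm
  have hvc : Continuous fun x ↦ ‖u x - w x‖ := (hu.continuous.sub hw.continuous).norm
  have hu' : Continuous fun x ↦ ‖fderiv ℝ u x‖ := (hu.continuous_fderiv one_ne_zero).norm
  have hw' : Continuous fun x ↦ ‖fderiv ℝ w x‖ := (hw.continuous_fderiv one_ne_zero).norm
  have hvL : MemLp (fun x ↦ ‖u x - w x‖) 2 := hvc.memLp_of_hasCompactSupport hv_supp
  have huL : MemLp (fun x ↦ ‖fderiv ℝ u x‖) 2 :=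
    hu'.memLp_of_hasCompactSupport (hu_supp.fderiv ℝ).norm
  have hwL : MemLp (fun x ↦ ‖fderiv ℝ w x‖) 2 :=
    hw'.memLp_of_hasCompactSupport (hw_supp.fderiv ℝ).norm
  have hiu : Integrable fun x ↦ ‖u x - w x‖ * ‖fderiv ℝ u x‖ :=
    (hvc.mul hu').integrable_of_hasCompactSupport hv_supp.mul_right
  have hiw : Integrable fun x ↦ ‖u x - w x‖ * ‖fderiv ℝ w x‖ :=
    (hvc.mul hw').integrable_of_hasCompactSupport hv_supp.mul_right
  rw [integral_mul_det_sub_det hu hw hu_supp hw_supp hφ, ← Real.norm_eq_abs]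
  calc _ ≤ ∫ x, K * (‖u x - w x‖ * ‖fderiv ℝ u x‖ + ‖u x - w x‖ * ‖fderiv ℝ w x‖) := by
        refine norm_integral_le_of_norm_le ((hiu.add hiw).const_mul K) (.of_forall fun x ↦ ?_)
        rw [norm_mul, ← mul_add]
        refine (mul_le_of_le_one_left (norm_nonneg _) (by norm_num)).trans ?_
        refine (abs_cofactor_pairing_le (fderiv ℝ φ x) (fderiv ℝ u x + fderiv ℝ w x)
          (u x - w x)).trans ?_
        gcongr
        · exact hK x
        · exact norm_add_le _ _
    _ = K * ((∫ x, ‖u x - w x‖ * ‖fderiv ℝ u x‖) + ∫ x, ‖u x - w x‖ * ‖fderiv ℝ w x‖) := by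
        rw [integral_const_mul, integral_add hiu hiw]
    _ ≤ K * (Real.sqrt (∫ x, ‖u x - w x‖ ^ 2) * Real.sqrt (∫ x, ‖fderiv ℝ u x‖ ^ 2) +
          Real.sqrt (∫ x, ‖u x - w x‖ ^ 2) * Real.sqrt (∫ x, ‖fderiv ℝ w x‖ ^ 2)) := by
        gcongr
        · exact integral_mul_le_sqrt_mul_sqrt hvL huL (fun _ ↦ norm_nonneg _) fun _ ↦ norm_nonneg _
        · exact integral_mul_le_sqrt_mul_sqrt hvL hwL (fun _ ↦ norm_nonneg _) fun _ ↦ norm_nonneg _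
    _ = _ := by ring
end

section
/- Let ρ > 0, K ≥ 0 and let f : ℝ² → [0, ∞] be measurable. For j ∈ ℕ set A_j := { x ∈ ℝ² : 2^{−(j+1)} ρ < ‖x‖ ≤ 2^{−j} ρ }. If ∫_{A_j} f(x)² dx ≤ K² for every j ∈ ℕ, then ∫_{{x : 0 < ‖x‖ ≤ ρ}} f(x) dx ≤ √(3π) · K · ρ; in particular, f is integrable on the punctured ball {0 < ‖x‖ ≤ ρ}. -/
open MeasureTheory

/-- The area of a planar annulus. -/
theorem EuclideanSpace.volume_annulus_fin_two {r R : ℝ} (hr : 0 ≤ r) (hrR : r ≤ R) :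
    volume {x : EuclideanSpace ℝ (Fin 2) | r < ‖x‖ ∧ ‖x‖ ≤ R} =
      ENNReal.ofReal (Real.pi * (R ^ 2 - r ^ 2)) := by
  have hset : {x : EuclideanSpace ℝ (Fin 2) | r < ‖x‖ ∧ ‖x‖ ≤ R} =
      Metric.closedBall 0 R \ Metric.closedBall 0 r := by
    ext x
    simp [and_comm]
  rw [hset, measure_sdiff (Metric.closedBall_subset_closedBall hrR)
    Metric.isClosed_closedBall.measurableSet.nullMeasurableSet measure_closedBall_lt_top.ne,
    EuclideanSpace.volume_closedBall_fin_two, EuclideanSpace.volume_closedBall_fin_two,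
    ← ENNReal.ofReal_pow (hr.trans hrR), ← ENNReal.ofReal_pow hr,
    ← ENNReal.ofReal_mul (by positivity), ← ENNReal.ofReal_mul (by positivity),
    ← ENNReal.ofReal_sub _ (by positivity)]
  congr 1
  ring

/-- The Cauchy-Schwarz inequality on a set of finite measure, with explicit real bounds. -/
theorem setLIntegral_le_ofReal_mul_of_sq_le {α : Type*} [MeasurableSpace α] {μ : Measure α}
    {s : Set α} {f : α → ENNReal} (hf : AEMeasurable f (μ.restrict s)) {K a : ℝ}
    (hK : 0 ≤ K) (ha : 0 ≤ a)
    (hint : ∫⁻ x in s, f x ^ 2 ∂μ ≤ ENNReal.ofReal (K ^ 2)) (hs : μ s ≤ ENNReal.ofReal (a ^ 2)) :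
    ∫⁻ x in s, f x ∂μ ≤ ENNReal.ofReal (K * a) := by
  have h := ENNReal.lintegral_mul_le_Lp_mul_Lq (μ.restrict s) Real.HolderConjugate.two_two hf
    (aemeasurable_const (b := (1 : ENNReal)))
  simp only [Pi.mul_apply, mul_one, ENNReal.rpow_ofNat, one_pow, lintegral_const, one_mul,
    Measure.restrict_apply_univ] at h
  have root {b : ℝ} (hb : 0 ≤ b) : ENNReal.ofReal (b ^ 2) ^ (1 / 2 : ℝ) = ENNReal.ofReal b := by
    rw [ENNReal.ofReal_rpow_of_nonneg (by positivity) (by norm_num), ← Real.sqrt_eq_rpow,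
      Real.sqrt_sq hb]
  calc ∫⁻ x in s, f x ∂μ
      ≤ (∫⁻ x in s, f x ^ 2 ∂μ) ^ (1 / 2 : ℝ) * μ s ^ (1 / 2 : ℝ) := h
    _ ≤ ENNReal.ofReal (K ^ 2) ^ (1 / 2 : ℝ) * ENNReal.ofReal (a ^ 2) ^ (1 / 2 : ℝ) := by gcongr
    _ = ENNReal.ofReal (K * a) := by rw [root hK, root ha, ENNReal.ofReal_mul hK]

/-- Every point of `(0, ρ]` lies in a dyadic interval `(2^{-(j+1)}ρ, 2^{-j}ρ]`. -/
theorem exists_dyadic_interval {ρ t : ℝ} (hρ : 0 < ρ) (ht : 0 < t) (htρ : t ≤ ρ) :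
    ∃ j : ℕ, (2 : ℝ) ^ (-((j : ℤ) + 1)) * ρ < t ∧ t ≤ (2 : ℝ) ^ (-(j : ℤ)) * ρ := by
  obtain ⟨j, hj, hj'⟩ := exists_nat_pow_near_of_lt_one (div_pos ht hρ)
    ((div_le_one hρ).2 htρ) (by norm_num : (0 : ℝ) < 1 / 2) (by norm_num)
  refine ⟨j, ?_, ?_⟩
  · rw [lt_div_iff₀ hρ] at hj
    rwa [← Nat.cast_succ, zpow_neg, zpow_natCast, ← inv_pow, ← one_div]
  · rw [div_le_iff₀ hρ] at hj'
    rwa [zpow_neg, zpow_natCast, ← inv_pow, ← one_div]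

/-- Dyadic annulus bound implies integrability on the punctured ball: if the squared
`L²` mass of `f` on each dyadic annulus `A_j = {2^{-(j+1)}ρ < ‖x‖ ≤ 2^{-j}ρ}` is at most
`K²`, then `∫ f` over the punctured ball of radius `ρ` is at most `√(3π) K ρ`;
in particular the integral is finite. -/
theorem integrable_of_dyadic_annulus_bound (ρ K : ℝ) (hρ : 0 < ρ) (hK : 0 ≤ K)
    (f : EuclideanSpace ℝ (Fin 2) → ENNReal) (hf : Measurable f)
    (hbound : ∀ j : ℕ,
      ∫⁻ x in {x : EuclideanSpace ℝ (Fin 2) |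
          (2 : ℝ) ^ (-((j : ℤ) + 1)) * ρ < ‖x‖ ∧ ‖x‖ ≤ (2 : ℝ) ^ (-(j : ℤ)) * ρ},
        (f x) ^ 2 ≤ ENNReal.ofReal (K ^ 2)) :
    (∫⁻ x in {x : EuclideanSpace ℝ (Fin 2) | 0 < ‖x‖ ∧ ‖x‖ ≤ ρ}, f x) ≤
        ENNReal.ofReal (Real.sqrt (3 * Real.pi) * K * ρ) ∧
      (∫⁻ x in {x : EuclideanSpace ℝ (Fin 2) | 0 < ‖x‖ ∧ ‖x‖ ≤ ρ}, f x) ≠ ⊤ := by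
  suffices h : ∫⁻ x in {x : EuclideanSpace ℝ (Fin 2) | 0 < ‖x‖ ∧ ‖x‖ ≤ ρ}, f x ≤
      ENNReal.ofReal (Real.sqrt (3 * Real.pi) * K * ρ) from
    ⟨h, ne_top_of_le_ne_top ENNReal.ofReal_ne_top h⟩
  set A : ℕ → Set (EuclideanSpace ℝ (Fin 2)) := fun j ↦
    {x | (2 : ℝ) ^ (-((j : ℤ) + 1)) * ρ < ‖x‖ ∧ ‖x‖ ≤ (2 : ℝ) ^ (-(j : ℤ)) * ρ} with hA
  set c : ℝ := Real.sqrt (3 * Real.pi) * ρ / 2 with hc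
  have hc0 : 0 ≤ c := by positivity
  have hvol (j : ℕ) : volume (A j) = ENNReal.ofReal ((c * (1 / 2) ^ j) ^ 2) := by
    have hsucc : (2 : ℝ) ^ (-((j : ℤ) + 1)) = (1 / 2) ^ j / 2 := by
      rw [← Nat.cast_succ, zpow_neg, zpow_natCast, ← inv_pow, ← one_div, pow_succ]
      ring
    have hj : (2 : ℝ) ^ (-(j : ℤ)) = (1 / 2) ^ j := by
      rw [zpow_neg, zpow_natCast, ← inv_pow, ← one_div]
    have hpos : (0 : ℝ) < (1 / 2) ^ j := by positivity
    simp only [hA, hsucc, hj]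
    rw [EuclideanSpace.volume_annulus_fin_two (by positivity) (by gcongr; linarith)]
    congr 1
    have hsq : Real.sqrt (3 * Real.pi) ^ 2 = 3 * Real.pi := Real.sq_sqrt (by positivity)
    rw [hc]
    linear_combination (-(ρ ^ 2 * ((1 / 2) ^ j) ^ 2 / 4)) * hsq
  have hAj (j : ℕ) : ∫⁻ x in A j, f x ≤ ENNReal.ofReal (K * (c * (1 / 2) ^ j)) :=
    setLIntegral_le_ofReal_mul_of_sq_le hf.aemeasurable hK (by positivity) (hbound j) (hvol j).le
  have hsum : HasSum (fun j : ℕ ↦ K * (c * (1 / 2 : ℝ) ^ j)) (K * (c * 2)) :=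
    (hasSum_geometric_two.mul_left c).mul_left K
  calc ∫⁻ x in {x : EuclideanSpace ℝ (Fin 2) | 0 < ‖x‖ ∧ ‖x‖ ≤ ρ}, f x
      ≤ ∫⁻ x in ⋃ j, A j, f x := lintegral_mono_set fun x hx ↦
        Set.mem_iUnion.2 (exists_dyadic_interval hρ hx.1 hx.2)
    _ ≤ ∑' j, ∫⁻ x in A j, f x := lintegral_iUnion_le _ _
    _ ≤ ∑' j : ℕ, ENNReal.ofReal (K * (c * (1 / 2) ^ j)) := ENNReal.tsum_le_tsum hAj
    _ = ENNReal.ofReal (K * (c * 2)) := by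
      rw [← ENNReal.ofReal_tsum_of_nonneg (fun j ↦ by positivity) hsum.summable, hsum.tsum_eq]
    _ = ENNReal.ofReal (Real.sqrt (3 * Real.pi) * K * ρ) := by
      rw [hc]
      congr 1
      ring
end
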